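/- Let Γ be a two-player zero-sum recursive game with countable state space and finite action sets at each state. If the family {v_n : n ≥ 1} of n-stage value functions is totally bounded for the uniform norm, then Γ has a uniform value v_∞; moreover, both players can uniformly guarantee v_∞ with strategies that depend on the history only through the sequence of states visited (and not on past actions). -/

import Mathlib

open scoped Classical
open Filter

noncomputable section

/-- A two-player zero-sum stochastic game: a state space `X`, action sets `A`, `B`
with a nonempty finite feasible subset at every state, a payoff function with values
in `[-1,1]`, and a finitely supported transition probability function. -/
structure StocGame where
  X : Type
  A : Type
  B : Type
  actA : X → Finset A
  actB : X → Finset B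
  actA_nonempty : ∀ x, (actA x).Nonempty
  actB_nonempty : ∀ x, (actB x).Nonempty
  g : X → A → B → ℝ
  g_bdd : ∀ x a b, |g x a b| ≤ 1
  q : X → A → B → X → ℝ
  q_nonneg : ∀ x a b y, 0 ≤ q x a b y
  q_finsupp : ∀ x a b, (Function.support (q x a b)).Finite
  q_sum : ∀ x a b, (∑' y, q x a b y) = 1

namespace StocGame

variable (G : StocGame)

/-- A behavior strategy of player 1: to every past history (a chronological list of
(state, action of player 1, action of player 2) triples) and every current state, it
assigns a mixed action supported on the feasible action set. -/
structure Strategy1 where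
  play : List (G.X × G.A × G.B) → G.X → G.A → ℝ
  nonneg : ∀ h x a, 0 ≤ play h x a
  supp : ∀ h x a, a ∉ G.actA x → play h x a = 0
  sum_one : ∀ h x, ∑ a ∈ G.actA x, play h x a = 1

/-- A behavior strategy of player 2. -/
structure Strategy2 where
  play : List (G.X × G.A × G.B) → G.X → G.B → ℝ
  nonneg : ∀ h x b, 0 ≤ play h x b
  supp : ∀ h x b, b ∉ G.actB x → play h x b = 0
  sum_one : ∀ h x, ∑ b ∈ G.actB x, play h x b = 1

variable {G}

/-- The chronological sequence of states visited along a finite history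
(past history together with the current state). -/
def stateSeq (hx : List (G.X × G.A × G.B) × G.X) : List G.X :=
  hx.1.map Prod.fst ++ [hx.2]

/-- A strategy of player 1 which depends on the history only through the sequence of
visited states (and not on past actions). -/
def Strategy1.stateDep (σ : Strategy1 G) : Prop :=
  ∀ h h' x, h.map Prod.fst = h'.map Prod.fst → σ.play h x = σ.play h' x

/-- A strategy of player 2 which depends on the history only through the sequence of
visited states (and not on past actions). -/
def Strategy2.stateDep (τ : Strategy2 G) : Prop :=
  ∀ h h' x, h.map Prod.fst = h'.map Prod.fst → τ.play h x = τ.play h' x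

/-- A pure strategy of player 1. -/
def Strategy1.pure (σ : Strategy1 G) : Prop :=
  ∀ h x, ∃ a ∈ G.actA x, σ.play h x a = 1

/-- A pure strategy of player 2. -/
def Strategy2.pure (τ : Strategy2 G) : Prop :=
  ∀ h x, ∃ b ∈ G.actB x, τ.play h x b = 1

variable (G)

/-- Auxiliary function: the probability of a finite history, the past history being
given in reverse chronological order. -/
def histProbAux (x₁ : G.X) (σ : Strategy1 G) (τ : Strategy2 G) :
    List (G.X × G.A × G.B) → G.X → ℝ
  | [], x => if x = x₁ then 1 else 0
  | (y, a, b) :: rest, x =>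
      histProbAux x₁ σ τ rest y * σ.play rest.reverse y a * τ.play rest.reverse y b *
        G.q y a b x

/-- Probability, in the game starting at `x₁` played with `(σ, τ)`, that the play starts
with the (chronological) past history `h` followed by the current state `x`. -/
def histProb (x₁ : G.X) (σ : Strategy1 G) (τ : Strategy2 G)
    (h : List (G.X × G.A × G.B)) (x : G.X) : ℝ :=
  G.histProbAux x₁ σ τ h.reverse x

/-- Expected payoff of stage `t` in the game starting at `x₁` played with `(σ, τ)`. -/
def stagePayoff (x₁ : G.X) (σ : Strategy1 G) (τ : Strategy2 G) (t : ℕ) : ℝ :=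
  ∑' hx : List (G.X × G.A × G.B) × G.X,
    if hx.1.length + 1 = t then
      G.histProb x₁ σ τ hx.1 hx.2 *
        ∑ a ∈ G.actA hx.2, ∑ b ∈ G.actB hx.2,
          σ.play hx.1 hx.2 a * τ.play hx.1 hx.2 b * G.g hx.2 a b
    else 0

/-- Expected average payoff `γ_n(x₁, σ, τ)` over the `n` first stages. -/
def avgPayoff (x₁ : G.X) (σ : Strategy1 G) (τ : Strategy2 G) (n : ℕ) : ℝ :=
  (n : ℝ)⁻¹ * ∑ t ∈ Finset.Icc 1 n, G.stagePayoff x₁ σ τ t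

/-- Expected `λ`-discounted payoff `γ_λ(x₁, σ, τ)`. -/
def discPayoff (x₁ : G.X) (σ : Strategy1 G) (τ : Strategy2 G) (lam : ℝ) : ℝ :=
  ∑' t : ℕ, lam * (1 - lam) ^ t * G.stagePayoff x₁ σ τ (t + 1)

/-- The value `v_n(x₁)` of the `n`-stage game (by the minmax theorem, the game has a
value, which is then equal to this maxmin). -/
def nValue (n : ℕ) (x₁ : G.X) : ℝ :=
  ⨆ σ : Strategy1 G, ⨅ τ : Strategy2 G, G.avgPayoff x₁ σ τ n

/-- The value `v_λ(x₁)` of the `λ`-discounted game. -/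
def lamValue (lam : ℝ) (x₁ : G.X) : ℝ :=
  ⨆ σ : Strategy1 G, ⨅ τ : Strategy2 G, G.discPayoff x₁ σ τ lam

/-- The pointwise limit superior `v(x) = limsup_n v_n(x)` of the `n`-stage values. -/
def limsupV (x : G.X) : ℝ := Filter.limsup (fun n => G.nValue n x) Filter.atTop

/-- The family `{v_n, n ≥ 1}` is totally bounded for the uniform norm: for every
`ε > 0` there is a finite subfamily within uniform distance `ε` of every member. -/
def TotallyBoundedValues : Prop :=
  ∀ ε > (0 : ℝ), ∃ S : Finset ℕ, (∀ m ∈ S, 1 ≤ m) ∧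
    ∀ n, 1 ≤ n → ∃ m ∈ S, ∀ x, |G.nValue n x - G.nValue m x| ≤ ε

/-- Probability that the sequence of the first states of the play is `s`. -/
def statesProb (x₁ : G.X) (σ : Strategy1 G) (τ : Strategy2 G) (s : List G.X) : ℝ :=
  ∑' hx : List (G.X × G.A × G.B) × G.X,
    if stateSeq hx = s then G.histProb x₁ σ τ hx.1 hx.2 else 0

end StocGame

/-- A two-player zero-sum recursive game: a stochastic game whose state space is
partitioned into active states (where the payoff is `0`) and absorbing states (which
are trapping, with a payoff depending only on the state). -/
structure RecGame extends StocGame where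
  absorbing : X → Prop
  g_active : ∀ x a b, ¬ absorbing x → g x a b = 0
  absorbing_q : ∀ x a b, absorbing x → q x a b x = 1
  absorbing_g : ∀ x a b a' b', absorbing x → g x a b = g x a' b'

namespace RecGame

variable (G : RecGame)

/-- The stage payoff as a function of the state only: `0` on active states, and the
absorbing payoff on absorbing states. -/
def stateg (x : G.X) : ℝ :=
  G.g x (G.actA_nonempty x).choose (G.actB_nonempty x).choose

/-- Probability that the play is absorbed within the first `N` stages; since absorbing
states are trapping this is the probability that the state of stage `N` is absorbing,
i.e. `P(ρ ≤ N)` where `ρ` is the absorption time. -/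
def absorbedProb (x₁ : G.X) (σ : G.toStocGame.Strategy1) (τ : G.toStocGame.Strategy2)
    (N : ℕ) : ℝ :=
  ∑' hx : List (G.X × G.A × G.B) × G.X,
    if hx.1.length + 1 = N ∧ G.absorbing hx.2 then
      G.toStocGame.histProb x₁ σ τ hx.1 hx.2 else 0

/-- A uniformly terminating strategy of player 1. -/
def UniformlyTerminating1 (σ : G.toStocGame.Strategy1) : Prop :=
  ∀ ε > (0 : ℝ), ∃ N : ℕ, 1 ≤ N ∧ ∀ x₁, ¬ G.absorbing x₁ →
    ∀ τ, G.absorbedProb x₁ σ τ N ≥ 1 - ε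

end RecGame

/-- The mixed actions supported on a finite set `S`. -/
def mixedActions {α : Type*} (S : Finset α) : Set (α → ℝ) :=
  {p | (∀ a, 0 ≤ p a) ∧ (∀ a, a ∉ S → p a = 0) ∧ ∑ a ∈ S, p a = 1}

theorem convex_mixedActions {α : Type*} (S : Finset α) : Convex ℝ (mixedActions S) := by
  rintro p ⟨hp, hp', hp1⟩ q ⟨hq, hq', hq1⟩ u w hu hw huw
  refine ⟨fun a => ?_, fun a ha => ?_, ?_⟩
  · have := hp a
    have := hq a
    simp only [Pi.add_apply, Pi.smul_apply, smul_eq_mul]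
    positivity
  · simp [hp' a ha, hq' a ha]
  · simp [Finset.sum_add_distrib, ← Finset.mul_sum, hp1, hq1, huw]

theorem isCompact_mixedActions {α : Type*} (S : Finset α) : IsCompact (mixedActions S) := by
  have hK : IsCompact (Set.univ.pi fun _ : α => Set.Icc (0 : ℝ) 1) :=
    isCompact_univ_pi fun _ => isCompact_Icc
  refine hK.of_isClosed_subset ?_ ?_
  · have h1 : IsClosed {p : α → ℝ | ∀ a, 0 ≤ p a} := by
      simp only [Set.ofPred_forall]
      exact isClosed_iInter fun a => isClosed_le continuous_const (continuous_apply a)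
    have h2 : IsClosed {p : α → ℝ | ∀ a, a ∉ S → p a = 0} := by
      simp only [Set.ofPred_forall]
      exact isClosed_iInter fun a => isClosed_iInter fun _ =>
        isClosed_eq (continuous_apply a) continuous_const
    have h3 : IsClosed {p : α → ℝ | ∑ a ∈ S, p a = 1} :=
      isClosed_eq (continuous_finsetSum _ fun a _ => continuous_apply a) continuous_const
    exact h1.inter (h2.inter h3)
  · rintro p ⟨hp, hp', hp1⟩ a -
    refine ⟨hp a, ?_⟩
    by_cases ha : a ∈ S
    · rw [← hp1]
      exact Finset.single_le_sum (fun i _ => hp i) ha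
    · rw [hp' a ha]
      exact zero_le_one

theorem single_mem_mixedActions {α : Type*} {S : Finset α} {a : α} (ha : a ∈ S) :
    Pi.single a 1 ∈ mixedActions S := by
  refine ⟨fun b => ?_, fun b hb => ?_, ?_⟩
  · by_cases h : b = a
    · subst h; simp
    · simp [h]
  · have : b ≠ a := by rintro rfl; exact hb ha
    simp [this]
  · simp [Pi.single_apply, ha]

/-- The minmax theorem for matrix games. -/
theorem exists_matrix_value {α β : Type*} {S : Finset α} {T : Finset β} (hS : S.Nonempty)
    (hT : T.Nonempty) (m : α → β → ℝ) :
    ∃ w : ℝ, ∃ p ∈ mixedActions S, ∃ s ∈ mixedActions T,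
      (∀ b ∈ T, w ≤ ∑ a ∈ S, p a * m a b) ∧ (∀ a ∈ S, ∑ b ∈ T, s b * m a b ≤ w) := by
  let f : (β → ℝ) → (α → ℝ) → ℝ := fun s p => ∑ a ∈ S, ∑ b ∈ T, p a * (s b * m a b)
  have hc1 : ∀ p, Continuous fun s => f s p := fun p => by
    refine continuous_finsetSum _ fun a _ => continuous_finsetSum _ fun b _ => ?_
    exact continuous_const.mul ((continuous_apply b).mul continuous_const)
  have hc2 : ∀ s, Continuous fun p => f s p := fun s => by
    refine continuous_finsetSum _ fun a _ => continuous_finsetSum _ fun b _ => ?_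
    exact (continuous_apply a).mul continuous_const
  obtain ⟨s, hs, p, hp, hsp⟩ := Sion.exists_isSaddlePointOn (X := mixedActions T)
    (Y := mixedActions S) (f := f)
    (hT.elim fun b hb => ⟨_, single_mem_mixedActions hb⟩)
    (convex_mixedActions T) (isCompact_mixedActions T)
    (fun p _ => (hc1 p).lowerSemicontinuous.lowerSemicontinuousOn _)
    (fun p _ => ConvexOn.quasiconvexOn ⟨convex_mixedActions T, fun s _ s' _ u w _ _ _ => by
      refine le_of_eq ?_
      simp only [f, Pi.add_apply, Pi.smul_apply, smul_eq_mul, Finset.mul_sum,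
        ← Finset.sum_add_distrib]
      refine Finset.sum_congr rfl fun a _ => Finset.sum_congr rfl fun b _ => by ring⟩)
    (convex_mixedActions S) (hS.elim fun a ha => ⟨_, single_mem_mixedActions ha⟩)
    (isCompact_mixedActions S)
    (fun s _ => (hc2 s).upperSemicontinuous.upperSemicontinuousOn _)
    (fun s _ => ConcaveOn.quasiconcaveOn ⟨convex_mixedActions S, fun p _ p' _ u w _ _ _ => by
      refine le_of_eq ?_
      simp only [f, Pi.add_apply, Pi.smul_apply, smul_eq_mul, Finset.mul_sum,
        ← Finset.sum_add_distrib]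
      refine Finset.sum_congr rfl fun a _ => Finset.sum_congr rfl fun b _ => by ring⟩)
  refine ⟨f s p, p, hp, s, hs, fun b hb => ?_, fun a ha => ?_⟩
  · have := hsp _ (single_mem_mixedActions hb) _ hp
    refine this.trans (le_of_eq ?_)
    refine Finset.sum_congr rfl fun a _ => ?_
    simp [Pi.single_apply, hb]
  · have := hsp _ hs _ (single_mem_mixedActions ha)
    refine le_trans (le_of_eq ?_) this
    simp [f, Pi.single_apply, ha]

theorem le_bilinear_of_forall_le {α β : Type*} {S : Finset α} {T : Finset β} {m : α → β → ℝ}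
    {p : α → ℝ} {s : β → ℝ} {w : ℝ} (hs : s ∈ mixedActions T)
    (h : ∀ b ∈ T, w ≤ ∑ a ∈ S, p a * m a b) :
    w ≤ ∑ a ∈ S, ∑ b ∈ T, p a * s b * m a b := by
  rw [Finset.sum_comm]
  calc w = ∑ b ∈ T, s b * w := by rw [← Finset.sum_mul, hs.2.2, one_mul]
    _ ≤ ∑ b ∈ T, s b * ∑ a ∈ S, p a * m a b :=
      Finset.sum_le_sum fun b hb => mul_le_mul_of_nonneg_left (h b hb) (hs.1 b)
    _ = _ := by
      refine Finset.sum_congr rfl fun b _ => ?_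
      rw [Finset.mul_sum]
      exact Finset.sum_congr rfl fun a _ => by ring

theorem bilinear_le_of_forall_le {α β : Type*} {S : Finset α} {T : Finset β} {m : α → β → ℝ}
    {p : α → ℝ} {s : β → ℝ} {w : ℝ} (hp : p ∈ mixedActions S)
    (h : ∀ a ∈ S, ∑ b ∈ T, s b * m a b ≤ w) :
    ∑ a ∈ S, ∑ b ∈ T, p a * s b * m a b ≤ w := by
  calc _ = ∑ a ∈ S, p a * ∑ b ∈ T, s b * m a b := by
        refine Finset.sum_congr rfl fun a _ => ?_
        rw [Finset.mul_sum]
        exact Finset.sum_congr rfl fun b _ => by ring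
    _ ≤ ∑ a ∈ S, p a * w :=
      Finset.sum_le_sum fun a ha => mul_le_mul_of_nonneg_left (h a ha) (hp.1 a)
    _ = w := by rw [← Finset.sum_mul, hp.2.2, one_mul]

theorem bilinear_mono {α β : Type*} {S : Finset α} {T : Finset β} {m m' : α → β → ℝ}
    {p : α → ℝ} {s : β → ℝ} (hp : p ∈ mixedActions S) (hs : s ∈ mixedActions T)
    (h : ∀ a b, m a b ≤ m' a b) :
    ∑ a ∈ S, ∑ b ∈ T, p a * s b * m a b ≤ ∑ a ∈ S, ∑ b ∈ T, p a * s b * m' a b :=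
  Finset.sum_le_sum fun a _ => Finset.sum_le_sum fun b _ =>
    mul_le_mul_of_nonneg_left (h a b) (mul_nonneg (hp.1 a) (hs.1 b))

theorem bilinear_affine {α β : Type*} {S : Finset α} {T : Finset β} (m : α → β → ℝ)
    {p : α → ℝ} {s : β → ℝ} (hp : p ∈ mixedActions S) (hs : s ∈ mixedActions T) (k d : ℝ) :
    ∑ a ∈ S, ∑ b ∈ T, p a * s b * (k * m a b + d) =
      k * ∑ a ∈ S, ∑ b ∈ T, p a * s b * m a b + d := by
  have h1 : ∑ a ∈ S, ∑ b ∈ T, p a * s b = 1 := by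
    simp only [← Finset.mul_sum, hs.2.2, mul_one, hp.2.2]
  have h2 : ∑ a ∈ S, ∑ b ∈ T, p a * s b * (k * m a b + d) =
      k * (∑ a ∈ S, ∑ b ∈ T, p a * s b * m a b) + (∑ a ∈ S, ∑ b ∈ T, p a * s b) * d := by
    simp only [Finset.mul_sum, Finset.sum_mul, ← Finset.sum_add_distrib]
    exact Finset.sum_congr rfl fun a _ => Finset.sum_congr rfl fun b _ => by ring
  rw [h2, h1, one_mul]

namespace StocGame

variable (G : StocGame)

/-- Expectation of `F` at the state following `x` when the actions `a`, `b` are played. -/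
def nextExp (F : G.X → ℝ) (x : G.X) (a : G.A) (b : G.B) : ℝ :=
  ∑ y ∈ (G.q_finsupp x a b).toFinset, G.q x a b y * F y

theorem sum_q (x : G.X) (a : G.A) (b : G.B) :
    ∑ y ∈ (G.q_finsupp x a b).toFinset, G.q x a b y = 1 := by
  rw [← G.q_sum x a b]
  refine (tsum_eq_sum fun y hy => ?_).symm
  simpa using hy

theorem nextExp_mono {F F' : G.X → ℝ} (h : ∀ y, F y ≤ F' y) (x : G.X) (a : G.A) (b : G.B) :
    G.nextExp F x a b ≤ G.nextExp F' x a b :=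
  Finset.sum_le_sum fun y _ => mul_le_mul_of_nonneg_left (h y) (G.q_nonneg x a b y)

theorem nextExp_affine (F : G.X → ℝ) (k d : ℝ) (x : G.X) (a : G.A) (b : G.B) :
    G.nextExp (fun y => k * F y + d) x a b = k * G.nextExp F x a b + d := by
  have h : G.nextExp (fun y => k * F y + d) x a b = k * G.nextExp F x a b +
      (∑ y ∈ (G.q_finsupp x a b).toFinset, G.q x a b y) * d := by
    simp only [nextExp, Finset.mul_sum, Finset.sum_mul, ← Finset.sum_add_distrib]
    exact Finset.sum_congr rfl fun y _ => by ring
  rw [h, sum_q, one_mul]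

/-- The value of the one-shot game with continuation payoff `F`. -/
def oneShot (F : G.X → ℝ) (x : G.X) : ℝ :=
  (exists_matrix_value (G.actA_nonempty x) (G.actB_nonempty x) (G.nextExp F x)).choose

theorem oneShot_spec (F : G.X → ℝ) (x : G.X) :
    ∃ p ∈ mixedActions (G.actA x), ∃ s ∈ mixedActions (G.actB x),
      (∀ b ∈ G.actB x, G.oneShot F x ≤ ∑ a ∈ G.actA x, p a * G.nextExp F x a b) ∧
      (∀ a ∈ G.actA x, ∑ b ∈ G.actB x, s b * G.nextExp F x a b ≤ G.oneShot F x) :=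
  (exists_matrix_value (G.actA_nonempty x) (G.actB_nonempty x) (G.nextExp F x)).choose_spec

/-- An optimal mixed action of player 1 in the one-shot game. -/
def optA (F : G.X → ℝ) (x : G.X) : G.A → ℝ := (G.oneShot_spec F x).choose

theorem optA_mem (F : G.X → ℝ) (x : G.X) : G.optA F x ∈ mixedActions (G.actA x) :=
  (G.oneShot_spec F x).choose_spec.1

/-- An optimal mixed action of player 2 in the one-shot game. -/
def optB (F : G.X → ℝ) (x : G.X) : G.B → ℝ := (G.oneShot_spec F x).choose_spec.2.choose

theorem optB_mem (F : G.X → ℝ) (x : G.X) : G.optB F x ∈ mixedActions (G.actB x) :=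
  (G.oneShot_spec F x).choose_spec.2.choose_spec.1

theorem oneShot_le (F : G.X → ℝ) (x : G.X) {s : G.B → ℝ} (hs : s ∈ mixedActions (G.actB x)) :
    G.oneShot F x ≤ ∑ a ∈ G.actA x, ∑ b ∈ G.actB x, G.optA F x a * s b * G.nextExp F x a b :=
  le_bilinear_of_forall_le hs (G.oneShot_spec F x).choose_spec.2.choose_spec.2.1

theorem le_oneShot (F : G.X → ℝ) (x : G.X) {p : G.A → ℝ} (hp : p ∈ mixedActions (G.actA x)) :
    ∑ a ∈ G.actA x, ∑ b ∈ G.actB x, p a * G.optB F x b * G.nextExp F x a b ≤ G.oneShot F x :=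
  bilinear_le_of_forall_le hp (G.oneShot_spec F x).choose_spec.2.choose_spec.2.2

theorem oneShot_le_affine {F F' : G.X → ℝ} {k d : ℝ} (h : ∀ y, F y ≤ k * F' y + d)
    (hk : 0 ≤ k) (x : G.X) : G.oneShot F x ≤ k * G.oneShot F' x + d := by
  have hp := G.optA_mem F x
  have hs := G.optB_mem F' x
  calc G.oneShot F x
      ≤ ∑ a ∈ G.actA x, ∑ b ∈ G.actB x, G.optA F x a * G.optB F' x b * G.nextExp F x a b :=
        G.oneShot_le F x hs
    _ ≤ ∑ a ∈ G.actA x, ∑ b ∈ G.actB x, G.optA F x a * G.optB F' x b *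
          (k * G.nextExp F' x a b + d) := by
        refine bilinear_mono hp hs fun a b => ?_
        rw [← nextExp_affine]
        exact G.nextExp_mono h x a b
    _ = k * (∑ a ∈ G.actA x, ∑ b ∈ G.actB x, G.optA F x a * G.optB F' x b *
          G.nextExp F' x a b) + d := bilinear_affine _ hp hs k d
    _ ≤ k * G.oneShot F' x + d := by
        have := G.le_oneShot F' x hp
        gcongr

theorem oneShot_mono {F F' : G.X → ℝ} (h : ∀ y, F y ≤ F' y) (x : G.X) :
    G.oneShot F x ≤ G.oneShot F' x := by
  have := G.oneShot_le_affine (k := 1) (d := 0) (F := F) (F' := F') (by simpa using h)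
    zero_le_one x
  simpa using this

theorem oneShot_le_const {F : G.X → ℝ} {d : ℝ} (h : ∀ y, F y ≤ d) (x : G.X) :
    G.oneShot F x ≤ d := by
  have := G.oneShot_le_affine (k := 0) (F := F) (F' := F) (d := d) (by simpa using h) le_rfl x
  simpa using this

variable {G}

theorem Strategy1.mem (σ : Strategy1 G) (h : List (G.X × G.A × G.B)) (x : G.X) :
    σ.play h x ∈ mixedActions (G.actA x) :=
  ⟨σ.nonneg h x, σ.supp h x, σ.sum_one h x⟩

theorem Strategy2.mem (τ : Strategy2 G) (h : List (G.X × G.A × G.B)) (x : G.X) :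
    τ.play h x ∈ mixedActions (G.actB x) :=
  ⟨τ.nonneg h x, τ.supp h x, τ.sum_one h x⟩

variable (G)

/-- Extension of a history by one stage. -/
def extend (z : Σ _ : List (G.X × G.A × G.B) × G.X, Σ _ : G.A × G.B, G.X) :
    List (G.X × G.A × G.B) × G.X :=
  (z.1.1 ++ [(z.1.2, z.2.1.1, z.2.1.2)], z.2.2)

theorem extend_injective : Function.Injective G.extend := by
  rintro ⟨⟨h, x⟩, ⟨a, b⟩, y⟩ ⟨⟨h', x'⟩, ⟨a', b'⟩, y'⟩ e
  simp only [extend, Prod.mk.injEq] at e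
  obtain ⟨e1, rfl⟩ := e
  obtain ⟨rfl, e2⟩ := List.append_inj' e1 rfl
  simp only [List.cons.injEq, Prod.mk.injEq, and_true] at e2
  obtain ⟨rfl, rfl, rfl⟩ := e2
  rfl

/-- The finite set of histories of length `t` that are compatible with the rules. -/
def hists (x₁ : G.X) : ℕ → Finset (List (G.X × G.A × G.B) × G.X)
  | 0 => {([], x₁)}
  | t + 1 => ((hists x₁ t).sigma fun p => (G.actA p.2 ×ˢ G.actB p.2).sigma fun ab =>
      (G.q_finsupp p.2 ab.1 ab.2).toFinset).image G.extend

variable (x₁ : G.X) (σ : Strategy1 G) (τ : Strategy2 G)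

/-- Expectation of a function of the history of length `t`. -/
def histExp (t : ℕ) (F : List (G.X × G.A × G.B) → G.X → ℝ) : ℝ :=
  ∑ p ∈ G.hists x₁ t, G.histProb x₁ σ τ p.1 p.2 * F p.1 p.2

theorem histProb_append (h : List (G.X × G.A × G.B)) (x y : G.X) (a : G.A) (b : G.B) :
    G.histProb x₁ σ τ (h ++ [(x, a, b)]) y =
      G.histProb x₁ σ τ h x * σ.play h x a * τ.play h x b * G.q x a b y := by
  simp [histProb, histProbAux]

theorem histProb_nonneg (h : List (G.X × G.A × G.B)) (x : G.X) :
    0 ≤ G.histProb x₁ σ τ h x := by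
  induction h using List.reverseRecOn generalizing x with
  | nil =>
    simp only [histProb, histProbAux, List.reverse_nil]
    split_ifs <;> norm_num
  | append_singleton h z ih =>
    obtain ⟨y, a, b⟩ := z
    rw [histProb_append]
    have := ih y
    have := σ.nonneg h y a
    have := τ.nonneg h y b
    have := G.q_nonneg y a b x
    positivity

theorem mem_hists_of_histProb_ne_zero (h : List (G.X × G.A × G.B)) (x : G.X)
    (hp : G.histProb x₁ σ τ h x ≠ 0) : (h, x) ∈ G.hists x₁ h.length := by
  induction h using List.reverseRecOn generalizing x with
  | nil =>
    simp only [histProb, histProbAux, List.reverse_nil] at hp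
    simpa [hists] using hp
  | append_singleton h z ih =>
    obtain ⟨y, a, b⟩ := z
    rw [histProb_append] at hp
    simp only [ne_eq, mul_eq_zero, not_or] at hp
    obtain ⟨⟨⟨h1, h2⟩, h3⟩, h4⟩ := hp
    simp only [List.length_append, List.length_singleton, hists, Finset.mem_image]
    refine ⟨⟨(h, y), (a, b), x⟩, ?_, rfl⟩
    simp only [Finset.mem_sigma, Finset.mem_product, Set.Finite.mem_toFinset,
      Function.mem_support]
    exact ⟨ih y h1, ⟨not_imp_comm.1 (σ.supp h y a) h2, not_imp_comm.1 (τ.supp h y b) h3⟩, h4⟩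

theorem length_of_mem_hists {t : ℕ} {p : List (G.X × G.A × G.B) × G.X}
    (hp : p ∈ G.hists x₁ t) : p.1.length = t := by
  induction t generalizing p with
  | zero =>
    simp only [hists, Finset.mem_singleton] at hp
    simp [hp]
  | succ t ih =>
    simp only [hists, Finset.mem_image, Finset.mem_sigma] at hp
    obtain ⟨z, ⟨hz, -⟩, rfl⟩ := hp
    simp [extend, ih hz]

theorem histExp_zero (F : List (G.X × G.A × G.B) → G.X → ℝ) :
    G.histExp x₁ σ τ 0 F = F [] x₁ := by
  simp [histExp, hists, histProb, histProbAux]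

theorem histExp_succ (t : ℕ) (F : List (G.X × G.A × G.B) → G.X → ℝ) :
    G.histExp x₁ σ τ (t + 1) F = G.histExp x₁ σ τ t fun h x =>
      ∑ a ∈ G.actA x, ∑ b ∈ G.actB x, σ.play h x a * τ.play h x b *
        G.nextExp (F (h ++ [(x, a, b)])) x a b := by
  simp only [histExp, hists]
  rw [Finset.sum_image G.extend_injective.injOn, Finset.sum_sigma]
  refine Finset.sum_congr rfl fun p _ => ?_
  rw [Finset.sum_sigma, Finset.sum_product, Finset.mul_sum]
  refine Finset.sum_congr rfl fun a _ => ?_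
  rw [Finset.mul_sum]
  refine Finset.sum_congr rfl fun b _ => ?_
  simp only [nextExp, Finset.mul_sum]
  refine Finset.sum_congr rfl fun y _ => ?_
  simp only [extend, histProb_append]
  ring

theorem histExp_mono {t : ℕ} {F F' : List (G.X × G.A × G.B) → G.X → ℝ}
    (h : ∀ l x, l.length = t → F l x ≤ F' l x) :
    G.histExp x₁ σ τ t F ≤ G.histExp x₁ σ τ t F' :=
  Finset.sum_le_sum fun _ hp => mul_le_mul_of_nonneg_left
    (h _ _ (G.length_of_mem_hists x₁ hp)) (G.histProb_nonneg x₁ σ τ _ _)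

theorem histExp_add (t : ℕ) (F F' : List (G.X × G.A × G.B) → G.X → ℝ) :
    G.histExp x₁ σ τ t (fun h x => F h x + F' h x) =
      G.histExp x₁ σ τ t F + G.histExp x₁ σ τ t F' := by
  simp [histExp, mul_add, Finset.sum_add_distrib]

theorem histExp_mul (t : ℕ) (k : ℝ) (F : List (G.X × G.A × G.B) → G.X → ℝ) :
    G.histExp x₁ σ τ t (fun h x => k * F h x) = k * G.histExp x₁ σ τ t F := by
  simp only [histExp, Finset.mul_sum]
  exact Finset.sum_congr rfl fun p _ => by ring

theorem histExp_const (t : ℕ) (d : ℝ) : G.histExp x₁ σ τ t (fun _ _ => d) = d := by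
  induction t with
  | zero => rw [histExp_zero]
  | succ t ih =>
    rw [histExp_succ]
    refine Eq.trans ?_ ih
    congr 1
    ext h x
    have h1 : ∀ a b, G.nextExp (fun _ => d) x a b = 0 * 0 + d := fun a b => by
      simpa using G.nextExp_affine (fun _ => 0) 0 d x a b
    simp only [h1]
    rw [bilinear_affine (fun _ _ => (0 : ℝ)) (σ.mem h x) (τ.mem h x)]
    simp

theorem stagePayoff_succ (t : ℕ) :
    G.stagePayoff x₁ σ τ (t + 1) = G.histExp x₁ σ τ t fun h x =>
      ∑ a ∈ G.actA x, ∑ b ∈ G.actB x, σ.play h x a * τ.play h x b * G.g x a b := by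
  unfold stagePayoff
  rw [tsum_eq_sum (s := G.hists x₁ t)]
  · refine Finset.sum_congr rfl fun p hp => ?_
    rw [if_pos (by rw [G.length_of_mem_hists x₁ hp])]
  · rintro ⟨h, x⟩ hp
    dsimp only
    split_ifs with hl
    · have hl' : h.length = t := by omega
      subst hl'
      rw [not_imp_comm.1 (G.mem_hists_of_histProb_ne_zero x₁ σ τ h x) hp, zero_mul]
    · rfl

theorem avgPayoff_eq (n : ℕ) :
    G.avgPayoff x₁ σ τ n =
      (n : ℝ)⁻¹ * ∑ t ∈ Finset.range n, G.stagePayoff x₁ σ τ (t + 1) := by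
  rw [avgPayoff, Finset.range_eq_Ico, Finset.sum_Ico_add' (fun t => G.stagePayoff x₁ σ τ t) 0 n 1]
  rfl

end StocGame

namespace StocGame

variable {G : StocGame}

/-- The strategy of player 1 which plays optimally in the one-shot game whose continuation
payoff `φ l x` depends on the list `l` of past states and on the current state `x`. -/
def Strategy1.ofContinuation (φ : List G.X → G.X → G.X → ℝ) : Strategy1 G where
  play h x := G.optA (φ (h.map Prod.fst) x) x
  nonneg _ x := (G.optA_mem _ x).1
  supp _ x := (G.optA_mem _ x).2.1
  sum_one _ x := (G.optA_mem _ x).2.2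

/-- The strategy of player 2 which plays optimally in the one-shot game whose continuation
payoff `φ l x` depends on the list `l` of past states and on the current state `x`. -/
def Strategy2.ofContinuation (φ : List G.X → G.X → G.X → ℝ) : Strategy2 G where
  play h x := G.optB (φ (h.map Prod.fst) x) x
  nonneg _ x := (G.optB_mem _ x).1
  supp _ x := (G.optB_mem _ x).2.1
  sum_one _ x := (G.optB_mem _ x).2.2

theorem Strategy1.ofContinuation_stateDep (φ : List G.X → G.X → G.X → ℝ) :
    (Strategy1.ofContinuation φ).stateDep := by
  intro h h' x e
  simp only [Strategy1.ofContinuation, e]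

variable (G)

/-- The game in which the roles of the players are exchanged. -/
abbrev swap : StocGame where
  X := G.X
  A := G.B
  B := G.A
  actA := G.actB
  actB := G.actA
  actA_nonempty := G.actB_nonempty
  actB_nonempty := G.actA_nonempty
  g x b a := -G.g x a b
  g_bdd x b a := by rw [abs_neg]; exact G.g_bdd x a b
  q x b a := G.q x a b
  q_nonneg x b a := G.q_nonneg x a b
  q_finsupp x b a := G.q_finsupp x a b
  q_sum x b a := G.q_sum x a b

variable {G}

/-- A strategy of player 1 seen as a strategy of player 2 in the exchanged game. -/
def Strategy1.toSwap (σ : Strategy1 G) : Strategy2 G.swap where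
  play h x := σ.play (h.map fun z => (z.1, z.2.2, z.2.1)) x
  nonneg _ _ := σ.nonneg _ _
  supp _ _ := σ.supp _ _
  sum_one _ _ := σ.sum_one _ _

/-- A strategy of player 2 seen as a strategy of player 1 in the exchanged game. -/
def Strategy2.toSwap (τ : Strategy2 G) : Strategy1 G.swap where
  play h x := τ.play (h.map fun z => (z.1, z.2.2, z.2.1)) x
  nonneg _ _ := τ.nonneg _ _
  supp _ _ := τ.supp _ _
  sum_one _ _ := τ.sum_one _ _

theorem exists_toSwap_eq (σ : Strategy1 G.swap) :
    ∃ τ : Strategy2 G, τ.toSwap = σ ∧ (σ.stateDep → τ.stateDep) := by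
  obtain ⟨p, h1, h2, h3⟩ := σ
  refine ⟨⟨fun h x => p (h.map fun z => (z.1, z.2.2, z.2.1)) x, fun _ _ => h1 _ _,
    fun _ _ => h2 _ _, fun _ _ => h3 _ _⟩, ?_, fun hd h h' x e => ?_⟩
  · simp only [Strategy2.toSwap, List.map_map]
    congr 1
    funext h x
    congr 1
    exact List.map_id h
  · refine hd _ _ x ?_
    rw [List.map_map, List.map_map]
    exact e

theorem histExp_swap (x₁ : G.X) (σ : Strategy1 G) (τ : Strategy2 G) (t : ℕ)
    (F : List (G.X × G.B × G.A) → G.X → ℝ) :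
    G.swap.histExp x₁ τ.toSwap σ.toSwap t F =
      G.histExp x₁ σ τ t fun h x => F (h.map fun z => (z.1, z.2.2, z.2.1)) x := by
  induction t generalizing F with
  | zero =>
    rw [histExp_zero, histExp_zero]
    rfl
  | succ t ih =>
    rw [histExp_succ, histExp_succ]
    refine (ih _).trans ?_
    congr 1
    funext h x
    refine Finset.sum_comm.trans ?_
    refine Finset.sum_congr rfl fun a _ => Finset.sum_congr rfl fun b _ => ?_
    have e : (h.map fun z => (z.1, z.2.2, z.2.1)).map
        (fun z : G.X × G.B × G.A => (z.1, z.2.2, z.2.1)) = h := by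
      rw [List.map_map]
      exact List.map_id h
    rw [List.map_append]
    change τ.play (List.map _ (List.map _ h)) x b * σ.play (List.map _ (List.map _ h)) x a * _ = _
    rw [e, mul_comm (τ.play h x b)]
    rfl

theorem avgPayoff_swap (x₁ : G.X) (σ : Strategy1 G) (τ : Strategy2 G) (n : ℕ) :
    G.swap.avgPayoff x₁ τ.toSwap σ.toSwap n = -G.avgPayoff x₁ σ τ n := by
  rw [avgPayoff_eq, avgPayoff_eq, ← mul_neg, ← Finset.sum_neg_distrib]
  congr 1
  refine Finset.sum_congr rfl fun t _ => ?_
  rw [stagePayoff_succ, stagePayoff_succ, histExp_swap, ← neg_one_mul, ← histExp_mul]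
  congr 1
  funext h x
  refine Finset.sum_comm.trans ?_
  rw [Finset.mul_sum]
  refine Finset.sum_congr rfl fun a _ => ?_
  rw [Finset.mul_sum]
  refine Finset.sum_congr rfl fun b _ => ?_
  have e : (h.map fun z => (z.1, z.2.2, z.2.1)).map
      (fun z : G.X × G.B × G.A => (z.1, z.2.2, z.2.1)) = h := by
    rw [List.map_map]
    exact List.map_id h
  change τ.play (List.map _ (List.map _ h)) x b * σ.play (List.map _ (List.map _ h)) x a *
    -G.g x a b = _
  rw [e]
  ring

end StocGame

namespace RecGame

variable (G : RecGame)

/-- The recursive game in which the roles of the players are exchanged. -/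
abbrev swap : RecGame where
  toStocGame := G.toStocGame.swap
  absorbing := G.absorbing
  g_active x b a hx := by
    change -G.g x a b = 0
    rw [G.g_active x a b hx, neg_zero]
  absorbing_q x b a hx := G.absorbing_q x a b hx
  absorbing_g x b a b' a' hx := by
    change -G.g x a b = -G.g x a' b'
    rw [G.absorbing_g x a b a' b' hx]

theorem g_eq_stateg (x : G.X) (a : G.A) (b : G.B) : G.g x a b = G.stateg x := by
  by_cases hx : G.absorbing x
  · exact G.absorbing_g x a b _ _ hx
  · rw [stateg, G.g_active x _ _ hx, G.g_active x _ _ hx]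

theorem stateg_active {x : G.X} (hx : ¬ G.absorbing x) : G.stateg x = 0 :=
  G.g_active x _ _ hx

theorem abs_stateg_le (x : G.X) : |G.stateg x| ≤ 1 := G.g_bdd x _ _

theorem stateg_le (x : G.X) : G.stateg x ≤ 1 := (abs_le.1 (G.abs_stateg_le x)).2

theorem nextExp_absorbing (F : G.X → ℝ) {x : G.X} (hx : G.absorbing x) (a : G.A) (b : G.B) :
    G.nextExp F x a b = F x := by
  have hmem : x ∈ (G.q_finsupp x a b).toFinset := by
    simp [G.absorbing_q x a b hx]
  have hs := G.sum_q x a b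
  rw [← Finset.add_sum_erase _ _ hmem, G.absorbing_q x a b hx] at hs
  have h0 : ∑ y ∈ (G.q_finsupp x a b).toFinset.erase x, G.q x a b y = 0 := by linarith
  rw [Finset.sum_eq_zero_iff_of_nonneg fun y _ => G.q_nonneg x a b y] at h0
  rw [StocGame.nextExp, ← Finset.add_sum_erase _ _ hmem, G.absorbing_q x a b hx,
    Finset.sum_eq_zero fun y hy => by rw [h0 y hy, zero_mul]]
  ring

theorem oneShot_absorbing (F : G.X → ℝ) {x : G.X} (hx : G.absorbing x) :
    G.oneShot F x = F x := by
  have hp := G.optA_mem F x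
  have hs := G.optB_mem F x
  have h1 := G.oneShot_le F x hs
  have h2 := G.le_oneShot F x hp
  have h3 : ∑ a ∈ G.actA x, ∑ b ∈ G.actB x, G.optA F x a * G.optB F x b * G.nextExp F x a b =
      F x := by
    simp only [G.nextExp_absorbing F hx]
    simpa using bilinear_affine (fun _ _ => (0 : ℝ)) hp hs 0 (F x)
  exact le_antisymm (h1.trans h3.le) (h3.ge.trans h2)

theorem stagePayoff_eq (x₁ : G.X) (σ : G.toStocGame.Strategy1) (τ : G.toStocGame.Strategy2)
    (t : ℕ) :
    G.stagePayoff x₁ σ τ (t + 1) = G.histExp x₁ σ τ t fun _ x => G.stateg x := by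
  rw [StocGame.stagePayoff_succ]
  congr 1
  funext h x
  simp only [G.g_eq_stateg]
  simpa using bilinear_affine (fun _ _ => (0 : ℝ)) (σ.mem h x) (τ.mem h x) 0 (G.stateg x)

theorem neg_one_le_avgPayoff (x₁ : G.X) (σ : G.toStocGame.Strategy1)
    (τ : G.toStocGame.Strategy2) (n : ℕ) : -1 ≤ G.avgPayoff x₁ σ τ n := by
  rw [StocGame.avgPayoff_eq]
  have h : -(n : ℝ) ≤ ∑ t ∈ Finset.range n, G.stagePayoff x₁ σ τ (t + 1) := by
    have : ∑ t ∈ Finset.range n, (-1 : ℝ) ≤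
        ∑ t ∈ Finset.range n, G.stagePayoff x₁ σ τ (t + 1) := by
      refine Finset.sum_le_sum fun t _ => ?_
      rw [stagePayoff_eq, ← G.histExp_const x₁ σ τ t (-1)]
      exact G.histExp_mono x₁ σ τ fun _ x _ => (abs_le.1 (G.abs_stateg_le x)).1
    simpa using this
  rcases Nat.eq_zero_or_pos n with rfl | hn
  · simp
  · have hn' : (0 : ℝ) < n := by exact_mod_cast hn
    rw [inv_mul_eq_div, le_div_iff₀ hn']
    linarith

/-- The total (not averaged) value of the game with `n` stages, defined recursively. -/
def totalValue : ℕ → G.X → ℝ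
  | 0, _ => 0
  | n + 1, x => G.stateg x + G.oneShot (totalValue n) x

theorem totalValue_absorbing {x : G.X} (hx : G.absorbing x) (n : ℕ) :
    G.totalValue n x = n * G.stateg x := by
  induction n with
  | zero => simp [totalValue]
  | succ n ih =>
    rw [totalValue, G.oneShot_absorbing _ hx, ih]
    push_cast
    ring

theorem totalValue_le (n : ℕ) (x : G.X) : G.totalValue n x ≤ n := by
  induction n generalizing x with
  | zero => simp [totalValue]
  | succ n ih =>
    rw [totalValue]
    have := G.oneShot_le_const ih x
    have := G.stateg_le x
    push_cast
    linarith

theorem exists_guarantee_totalValue (n : ℕ) :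
    ∃ σ : G.toStocGame.Strategy1, ∀ x₁ τ,
      G.totalValue n x₁ ≤ ∑ t ∈ Finset.range n, G.stagePayoff x₁ σ τ (t + 1) := by
  refine ⟨.ofContinuation fun l _ => G.totalValue (n - (l.length + 1)), fun x₁ τ => ?_⟩
  set σ : G.toStocGame.Strategy1 :=
    .ofContinuation fun l _ => G.totalValue (n - (l.length + 1)) with hσ
  have key : ∀ k ≤ n, G.totalValue n x₁ ≤
      ∑ t ∈ Finset.range k, G.stagePayoff x₁ σ τ (t + 1) +
        G.histExp x₁ σ τ k fun _ x => G.totalValue (n - k) x := by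
    intro k
    induction k with
    | zero => simp [StocGame.histExp_zero]
    | succ k ih =>
      intro hk
      refine (ih (by omega)).trans ?_
      rw [Finset.sum_range_succ, add_assoc, stagePayoff_eq, StocGame.histExp_succ,
        ← StocGame.histExp_add]
      gcongr
      refine G.histExp_mono x₁ σ τ fun h x hl => ?_
      obtain ⟨m, hm⟩ : ∃ m, n - k = m + 1 := ⟨n - k - 1, by omega⟩
      have hm' : n - (k + 1) = m := by omega
      rw [hm, hm', totalValue]
      gcongr
      refine (G.oneShot_le _ x (τ.mem h x)).trans (le_of_eq ?_)
      simp [hσ, StocGame.Strategy1.ofContinuation, hl, hm']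
  have := key n le_rfl
  simpa [totalValue, StocGame.histExp_const] using this

theorem exists_defend_totalValue (n : ℕ) :
    ∃ τ : G.toStocGame.Strategy2, ∀ x₁ σ,
      ∑ t ∈ Finset.range n, G.stagePayoff x₁ σ τ (t + 1) ≤ G.totalValue n x₁ := by
  refine ⟨.ofContinuation fun l _ => G.totalValue (n - (l.length + 1)), fun x₁ σ => ?_⟩
  set τ : G.toStocGame.Strategy2 :=
    .ofContinuation fun l _ => G.totalValue (n - (l.length + 1)) with hτ
  have key : ∀ k ≤ n, ∑ t ∈ Finset.range k, G.stagePayoff x₁ σ τ (t + 1) +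
        (G.histExp x₁ σ τ k fun _ x => G.totalValue (n - k) x) ≤ G.totalValue n x₁ := by
    intro k
    induction k with
    | zero => simp [StocGame.histExp_zero]
    | succ k ih =>
      intro hk
      refine le_trans ?_ (ih (by omega))
      rw [Finset.sum_range_succ, add_assoc, stagePayoff_eq, StocGame.histExp_succ,
        ← StocGame.histExp_add]
      gcongr
      refine G.histExp_mono x₁ σ τ fun h x hl => ?_
      obtain ⟨m, hm⟩ : ∃ m, n - k = m + 1 := ⟨n - k - 1, by omega⟩
      have hm' : n - (k + 1) = m := by omega
      rw [hm, hm', totalValue]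
      gcongr
      refine le_trans (le_of_eq ?_) (G.le_oneShot _ x (σ.mem h x))
      simp [hτ, StocGame.Strategy2.ofContinuation, hl, hm']
  have := key n le_rfl
  simpa [totalValue, StocGame.histExp_const] using this

theorem exists_saddle (n : ℕ) (x : G.X) :
    ∃ (σ₀ : G.toStocGame.Strategy1) (τ₀ : G.toStocGame.Strategy2),
      (∀ τ, (n : ℝ)⁻¹ * G.totalValue n x ≤ G.avgPayoff x σ₀ τ n) ∧
      (∀ σ, G.avgPayoff x σ τ₀ n ≤ (n : ℝ)⁻¹ * G.totalValue n x) := by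
  obtain ⟨σ₀, hσ⟩ := G.exists_guarantee_totalValue n
  obtain ⟨τ₀, hτ⟩ := G.exists_defend_totalValue n
  refine ⟨σ₀, τ₀, fun τ => ?_, fun σ => ?_⟩
  · rw [StocGame.avgPayoff_eq]
    exact mul_le_mul_of_nonneg_left (hσ x τ) (by positivity)
  · rw [StocGame.avgPayoff_eq]
    exact mul_le_mul_of_nonneg_left (hτ x σ) (by positivity)

theorem nValue_eq_of_saddle {n : ℕ} {x : G.X} {w : ℝ} (σ₀ : G.toStocGame.Strategy1)
    (τ₀ : G.toStocGame.Strategy2) (hσ : ∀ τ, w ≤ G.avgPayoff x σ₀ τ n)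
    (hτ : ∀ σ, G.avgPayoff x σ τ₀ n ≤ w) : G.nValue n x = w := by
  have : Nonempty G.toStocGame.Strategy1 := ⟨σ₀⟩
  have : Nonempty G.toStocGame.Strategy2 := ⟨τ₀⟩
  have hle : ∀ σ, ⨅ τ, G.avgPayoff x σ τ n ≤ w := fun σ =>
    (ciInf_le ⟨-1, by rintro _ ⟨τ, rfl⟩; exact G.neg_one_le_avgPayoff x σ τ n⟩ τ₀).trans (hτ σ)
  refine le_antisymm (ciSup_le hle) ?_
  exact (le_ciInf hσ).trans (le_ciSup (f := fun σ => ⨅ τ, G.avgPayoff x σ τ n)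
    ⟨w, by rintro _ ⟨σ, rfl⟩; exact hle σ⟩ σ₀)

theorem nValue_eq (n : ℕ) (x : G.X) : G.nValue n x = (n : ℝ)⁻¹ * G.totalValue n x := by
  obtain ⟨σ₀, τ₀, h1, h2⟩ := G.exists_saddle n x
  exact G.nValue_eq_of_saddle σ₀ τ₀ h1 h2

theorem totalValue_eq (n : ℕ) (x : G.X) : G.totalValue n x = n * G.nValue n x := by
  rcases Nat.eq_zero_or_pos n with rfl | hn
  · simp [totalValue]
  · have : (n : ℝ) ≠ 0 := by positivity
    rw [nValue_eq, mul_inv_cancel_left₀ this]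

theorem nValue_swap (n : ℕ) (x : G.X) : G.swap.nValue n x = -G.nValue n x := by
  obtain ⟨σ₀, τ₀, h1, h2⟩ := G.exists_saddle n x
  rw [← G.nValue_eq n x] at h1 h2
  refine G.swap.nValue_eq_of_saddle τ₀.toSwap σ₀.toSwap (fun τ' => ?_) (fun σ' => ?_)
  · obtain ⟨p, hp1, hp2, hp3⟩ := τ'
    let σ : G.toStocGame.Strategy1 :=
      ⟨fun h x => p (h.map fun z => (z.1, z.2.2, z.2.1)) x, fun _ _ => hp1 _ _,
        fun _ _ => hp2 _ _, fun _ _ => hp3 _ _⟩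
    have e : σ.toSwap = ⟨p, hp1, hp2, hp3⟩ := by
      simp only [σ, StocGame.Strategy1.toSwap, List.map_map]
      congr 1
      funext h x
      congr 1
      exact List.map_id h
    rw [← e]
    refine le_of_le_of_eq ?_ (G.toStocGame.avgPayoff_swap x σ τ₀ n).symm
    exact neg_le_neg (h2 σ)
  · obtain ⟨τ, rfl, -⟩ := StocGame.exists_toSwap_eq σ'
    refine le_of_eq_of_le (G.toStocGame.avgPayoff_swap x σ₀ τ n) ?_
    exact neg_le_neg (h1 τ)

theorem abs_nValue_le (n : ℕ) (x : G.X) : |G.nValue n x| ≤ 1 := by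
  have key : ∀ G : RecGame, ∀ x : G.X, G.nValue n x ≤ 1 := fun G x => by
    rw [nValue_eq]
    calc (n : ℝ)⁻¹ * G.totalValue n x ≤ (n : ℝ)⁻¹ * n :=
          mul_le_mul_of_nonneg_left (G.totalValue_le n x) (by positivity)
      _ ≤ 1 := by
          rcases Nat.eq_zero_or_pos n with rfl | hn
          · simp
          · rw [inv_mul_cancel₀ (by positivity)]
  have h := key G.swap x
  rw [nValue_swap] at h
  exact abs_le.2 ⟨by linarith, key G x⟩

end RecGame

/-- In a totally bounded sequence, all but finitely many terms are close to infinitely many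
terms. -/
theorem eventually_frequently_close {X : Type*} {f : ℕ → X → ℝ}
    (hf : ∀ ε > (0 : ℝ), ∃ S : Finset ℕ, (∀ m ∈ S, 1 ≤ m) ∧
      ∀ n, 1 ≤ n → ∃ m ∈ S, ∀ x, |f n x - f m x| ≤ ε) {ε : ℝ} (hε : 0 < ε) :
    ∀ᶠ n in atTop, ∃ᶠ k in atTop, ∀ x, |f n x - f k x| ≤ ε := by
  obtain ⟨S, -, hS⟩ := hf (ε / 2) (half_pos hε)
  have h1 : ∀ᶠ n in atTop, ∀ m ∈ S, (∀ x, |f n x - f m x| ≤ ε / 2) →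
      ∃ᶠ k in atTop, ∀ x, |f k x - f m x| ≤ ε / 2 := by
    rw [Finset.eventually_all]
    intro m _
    by_cases h : ∃ᶠ k in atTop, ∀ x, |f k x - f m x| ≤ ε / 2
    · exact Eventually.of_forall fun _ _ => h
    · rw [not_frequently] at h
      exact h.mono fun n hn hn' => absurd hn' hn
  filter_upwards [h1, eventually_ge_atTop 1] with n hn hn1
  obtain ⟨m, hm, hnm⟩ := hS n hn1
  refine (hn m hm hnm).mono fun k hk x => ?_
  have e : f n x - f k x = (f n x - f m x) - (f k x - f m x) := by ring
  rw [e]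
  exact (abs_sub _ _).trans (by linarith [hnm x, hk x])

theorem isBoundedUnder_of_abs_le {f : ℕ → ℝ} (hf : ∀ n, |f n| ≤ 1) :
    IsBoundedUnder (· ≤ ·) atTop f ∧ IsBoundedUnder (· ≥ ·) atTop f :=
  ⟨isBoundedUnder_of ⟨1, fun n => (abs_le.1 (hf n)).2⟩,
    isBoundedUnder_of ⟨-1, fun n => (abs_le.1 (hf n)).1⟩⟩

/-- A totally bounded sequence is eventually uniformly bounded above by its limit superior. -/
theorem eventually_le_limsup_add {X : Type*} {f : ℕ → X → ℝ} (hb : ∀ n x, |f n x| ≤ 1)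
    (hf : ∀ ε > (0 : ℝ), ∃ S : Finset ℕ, (∀ m ∈ S, 1 ≤ m) ∧
      ∀ n, 1 ≤ n → ∃ m ∈ S, ∀ x, |f n x - f m x| ≤ ε) {ε : ℝ} (hε : 0 < ε) :
    ∀ᶠ n in atTop, ∀ x, f n x ≤ limsup (fun k => f k x) atTop + ε := by
  filter_upwards [eventually_frequently_close hf hε] with n hn x
  have h : f n x - ε ≤ limsup (fun k => f k x) atTop := by
    refine le_limsup_of_frequently_le (hn.mono fun k hk => ?_)
      (isBoundedUnder_of_abs_le fun k => hb k x).1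
    linarith [(abs_le.1 (hk x)).2]
  linarith

/-- The limit superior of a totally bounded sequence is attained, up to `ε`, at arbitrarily
large but uniformly bounded times. -/
theorem exists_bounded_limsup_sub_le {X : Type*} {f : ℕ → X → ℝ} (hb : ∀ n x, |f n x| ≤ 1)
    (hf : ∀ ε > (0 : ℝ), ∃ S : Finset ℕ, (∀ m ∈ S, 1 ≤ m) ∧
      ∀ n, 1 ≤ n → ∃ m ∈ S, ∀ x, |f n x - f m x| ≤ ε) {ε : ℝ} (hε : 0 < ε) (M : ℕ) :
    ∃ N, ∀ x, ∃ n, M ≤ n ∧ n ≤ N ∧ limsup (fun k => f k x) atTop - ε ≤ f n x := by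
  obtain ⟨S, -, hS⟩ := hf (ε / 3) (by positivity)
  have h1 : ∀ m, ∃ k, (∃ n ≥ M, ∀ x, |f n x - f m x| ≤ ε / 3) →
      M ≤ k ∧ ∀ x, |f k x - f m x| ≤ ε / 3 := fun m => by
    by_cases h : ∃ n ≥ M, ∀ x, |f n x - f m x| ≤ ε / 3
    · obtain ⟨k, hk, hk'⟩ := h
      exact ⟨k, fun _ => ⟨hk, hk'⟩⟩
    · exact ⟨0, fun h' => absurd h' h⟩
  choose k hk using h1
  refine ⟨S.sup k, fun x => ?_⟩
  have hfreq : ∃ᶠ n in atTop, limsup (fun k => f k x) atTop - ε / 3 < f n x :=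
    frequently_lt_of_lt_limsup (isBoundedUnder_of_abs_le fun k => hb k x).2.isCoboundedUnder_le
      (by linarith)
  obtain ⟨n, hn, hnM⟩ := (hfreq.and_eventually (eventually_ge_atTop (max 1 M))).exists
  obtain ⟨m, hm, hnm⟩ := hS n ((le_max_left _ _).trans hnM)
  obtain ⟨hkM, hkm⟩ := hk m ⟨n, (le_max_right _ _).trans hnM, hnm⟩
  refine ⟨k m, hkM, Finset.le_sup hm, ?_⟩
  linarith [(abs_le.1 (hnm x)).2, (abs_le.1 (hkm x)).1]

namespace RecGame

variable (G : RecGame)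

/-- The function `v` with a bonus `c` on the absorbing states. -/
def bonusValue (v : G.X → ℝ) (c : ℝ) (x : G.X) : ℝ :=
  if G.absorbing x then G.stateg x + c else v x

/-- The value of the game in which player 1 may stop within `r` stages and get the bonus value,
and must stop where `v` is nonpositive. -/
def stopValue (v : G.X → ℝ) (c : ℝ) : ℕ → G.X → ℝ
  | 0, x => G.bonusValue v c x
  | r + 1, x => if ¬ G.absorbing x ∧ 0 < v x then
      max (G.bonusValue v c x) (G.oneShot (stopValue v c r) x) else G.bonusValue v c x

/-- Update of the number of remaining stages of the current block: a block of at most `N` stages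
starts when the state is active with `v > ε`, and stops as soon as it is optimal to stop. -/
def nextPhase (v : G.X → ℝ) (c ε : ℝ) (N r : ℕ) (y : G.X) : ℕ :=
  if 2 ≤ r ∧ ¬ G.absorbing y ∧ 0 < v y ∧ G.bonusValue v c y < G.stopValue v c (r - 1) y then r - 1
  else if ¬ G.absorbing y ∧ ε < v y then N else 0

/-- The potential attached to a state and a number of remaining stages in the current block. -/
def potential (v : G.X → ℝ) (c d : ℝ) (r : ℕ) (x : G.X) : ℝ :=
  if r = 0 then G.bonusValue v c x else G.oneShot (G.stopValue v c (r - 1)) x - d * r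

/-- The number of remaining stages in the current block after a sequence of states. -/
def phase (v : G.X → ℝ) (c ε : ℝ) (N : ℕ) (l : List G.X) : ℕ :=
  l.foldl (G.nextPhase v c ε N) 0

section

variable {G} {v : G.X → ℝ} {c : ℝ}

theorem bonusValue_le_stopValue (r : ℕ) (x : G.X) :
    G.bonusValue v c x ≤ G.stopValue v c r x := by
  cases r with
  | zero => exact le_rfl
  | succ r =>
    rw [stopValue]
    split_ifs
    · exact le_max_left _ _
    · exact le_rfl

theorem stopValue_mono : Monotone (G.stopValue v c) := by
  refine monotone_nat_of_le_succ fun r => ?_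
  induction r with
  | zero => exact fun x => bonusValue_le_stopValue 1 x
  | succ r ih =>
    intro x
    rw [stopValue, stopValue]
    split_ifs
    · exact max_le_max le_rfl (G.oneShot_mono ih x)
    · exact le_rfl

theorem bonusValue_le (hc : 0 ≤ c) (hv : ∀ x, v x ≤ 1) (x : G.X) :
    G.bonusValue v c x ≤ 1 + c := by
  rw [bonusValue]
  split_ifs
  · linarith [G.stateg_le x]
  · linarith [hv x]

theorem stopValue_le (hc : 0 ≤ c) (hv : ∀ x, v x ≤ 1) (r : ℕ) (x : G.X) :
    G.stopValue v c r x ≤ 1 + c := by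
  induction r generalizing x with
  | zero => exact bonusValue_le hc hv x
  | succ r ih =>
    rw [stopValue]
    split_ifs
    · exact max_le (bonusValue_le hc hv x) (G.oneShot_le_const ih x)
    · exact bonusValue_le hc hv x

theorem totalValue_le_stopValue (hc : 0 ≤ c) {δ M : ℝ} (hδ : 0 ≤ δ) (hM : 0 ≤ M)
    (hU : ∀ r x, G.totalValue r x ≤ r * v x + (r * δ + M)) (r : ℕ) (x : G.X) :
    G.totalValue r x ≤ r / (1 + c) * G.stopValue v c r x + (r * δ + M) := by
  have hc' : 0 < 1 + c := by linarith
  induction r generalizing x with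
  | zero => simpa [totalValue] using hM
  | succ r ih =>
    by_cases hx : G.absorbing x
    · have e : G.stopValue v c (r + 1) x = G.stateg x + c := by
        rw [stopValue, if_neg (by tauto), bonusValue, if_pos hx]
      rw [e, G.totalValue_absorbing hx]
      have h1 : G.stateg x ≤ (G.stateg x + c) / (1 + c) := by
        rw [le_div_iff₀ hc']
        nlinarith [G.stateg_le x]
      have h2 : ((r + 1 : ℕ) : ℝ) * G.stateg x ≤ (r + 1 : ℕ) * ((G.stateg x + c) / (1 + c)) :=
        mul_le_mul_of_nonneg_left h1 (by positivity)
      have h3 : ((r + 1 : ℕ) : ℝ) / (1 + c) * (G.stateg x + c) =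
        (r + 1 : ℕ) * ((G.stateg x + c) / (1 + c)) := by ring
      have h4 : 0 ≤ ((r + 1 : ℕ) : ℝ) * δ := by positivity
      linarith
    · by_cases hvx : 0 < v x
      · have h1 : G.oneShot (G.stopValue v c r) x ≤ G.stopValue v c (r + 1) x := by
          rw [stopValue, if_pos ⟨hx, hvx⟩]
          exact le_max_right _ _
        have h2 : 0 ≤ G.stopValue v c (r + 1) x := by
          refine le_trans ?_ (bonusValue_le_stopValue (r + 1) x)
          rw [bonusValue, if_neg hx]
          exact hvx.le
        have h3 := G.oneShot_le_affine ih (by positivity) x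
        rw [totalValue, G.stateg_active hx]
        have h4 : (r : ℝ) / (1 + c) * G.oneShot (G.stopValue v c r) x ≤
            r / (1 + c) * G.stopValue v c (r + 1) x :=
          mul_le_mul_of_nonneg_left h1 (by positivity)
        have h5 : 0 ≤ 1 / (1 + c) * G.stopValue v c (r + 1) x := by positivity
        have h6 : ((r + 1 : ℕ) : ℝ) / (1 + c) * G.stopValue v c (r + 1) x =
          r / (1 + c) * G.stopValue v c (r + 1) x + 1 / (1 + c) * G.stopValue v c (r + 1) x := by
          push_cast
          ring
        rw [h6]
        push_cast
        linarith
      · have e : G.stopValue v c (r + 1) x = v x := by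
          rw [stopValue, if_neg (by tauto), bonusValue, if_neg hx]
        rw [e]
        refine (hU (r + 1) x).trans ?_
        gcongr ?_ + _
        have h1 : v x ≤ v x / (1 + c) := by
          rw [le_div_iff₀ hc']
          nlinarith
        calc ((r + 1 : ℕ) : ℝ) * v x ≤ (r + 1 : ℕ) * (v x / (1 + c)) :=
              mul_le_mul_of_nonneg_left h1 (by positivity)
          _ = _ := by ring

end

section

variable {G} {v : G.X → ℝ} {c d ε : ℝ} {N : ℕ}

theorem bonusValue_le_potential_start (hN : N ≠ 0)
    (hgain : ∀ x, ¬ G.absorbing x → ε < v x →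
      G.bonusValue v c x + d * N ≤ G.oneShot (G.stopValue v c (N - 1)) x) (y : G.X) :
    G.bonusValue v c y ≤
      G.potential v c d (if ¬ G.absorbing y ∧ ε < v y then N else 0) y := by
  split_ifs with h
  · rw [potential, if_neg hN]
    linarith [hgain y h.1 h.2]
  · rw [potential, if_pos rfl]

theorem stopValue_le_potential (hd : 0 ≤ d) (hN : N ≠ 0)
    (hgain : ∀ x, ¬ G.absorbing x → ε < v x →
      G.bonusValue v c x + d * N ≤ G.oneShot (G.stopValue v c (N - 1)) x) (r : ℕ) (y : G.X) :
    G.stopValue v c (r - 1) y - d * (r - 1 : ℕ) ≤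
      G.potential v c d (G.nextPhase v c ε N r y) y := by
  have hstart := bonusValue_le_potential_start hN hgain y
  have hd' : 0 ≤ d * (r - 1 : ℕ) := by positivity
  rw [nextPhase]
  by_cases h : 2 ≤ r ∧ ¬ G.absorbing y ∧ 0 < v y ∧
      G.bonusValue v c y < G.stopValue v c (r - 1) y
  · rw [if_pos h]
    obtain ⟨h2, hy, hvy, hlt⟩ := h
    obtain ⟨s, rfl⟩ : ∃ s, r = s + 2 := ⟨r - 2, by omega⟩
    rw [potential, if_neg (by omega)]
    simp only [Nat.add_one_sub_one, show s + 2 - 1 = s + 1 by omega] at hlt ⊢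
    rw [stopValue, if_pos ⟨hy, hvy⟩] at hlt ⊢
    have hle : G.bonusValue v c y ≤ G.oneShot (G.stopValue v c s) y := by
      by_contra hcon
      rw [max_eq_left (not_le.1 hcon).le] at hlt
      exact lt_irrefl _ hlt
    rw [max_eq_right hle]
  · rw [if_neg h]
    suffices G.stopValue v c (r - 1) y ≤ G.bonusValue v c y by linarith
    obtain hr | ⟨s, rfl⟩ : r - 1 = 0 ∨ ∃ s, r = s + 2 := by
      rcases Nat.lt_or_ge r 2 with h2 | h2
      · exact Or.inl (by omega)
      · exact Or.inr ⟨r - 2, by omega⟩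
    · rw [hr]
      exact le_rfl
    · by_cases hy : ¬ G.absorbing y ∧ 0 < v y
      · by_contra hcon
        exact h ⟨by omega, hy.1, hy.2, not_le.1 hcon⟩
      · rw [show s + 2 - 1 = s + 1 by omega, stopValue, if_neg hy]

theorem nextPhase_ne_zero {r : ℕ} {x : G.X} (h : G.nextPhase v c ε N r x ≠ 0) :
    ¬ G.absorbing x := by
  intro hx
  simp [nextPhase, hx] at h

theorem nextPhase_eq_zero (hN : N ≠ 0) {r : ℕ} {x : G.X} (h : G.nextPhase v c ε N r x = 0)
    (hx : ¬ G.absorbing x) : v x ≤ ε := by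
  rw [nextPhase] at h
  split_ifs at h with h1 h2
  · omega
  · exact absurd h hN
  · by_contra hcon
    exact h2 ⟨hx, not_le.1 hcon⟩

theorem potential_le (hd : 0 ≤ d) (hc : 0 ≤ c) (hv : ∀ x, v x ≤ 1) (r : ℕ) (x : G.X) :
    G.potential v c d r x ≤ 1 + c := by
  rw [potential]
  split_ifs
  · exact bonusValue_le hc hv x
  · have := G.oneShot_le_const (stopValue_le hc hv (r - 1)) x
    have : 0 ≤ d * r := by positivity
    linarith

theorem potential_add_le (hsub : ∀ x, G.bonusValue v c x ≤ G.oneShot (G.bonusValue v c) x)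
    (r : ℕ) (x : G.X) :
    G.potential v c d r x + d * (if r = 0 then 0 else 1) ≤
      G.oneShot (G.stopValue v c (r - 1)) x - d * (r - 1 : ℕ) := by
  rw [potential]
  split_ifs with h
  · subst h
    have e : G.stopValue v c 0 = G.bonusValue v c := rfl
    simpa [e] using hsub x
  · obtain ⟨s, rfl⟩ := Nat.exists_eq_succ_of_ne_zero h
    simp only [Nat.succ_eq_add_one, Nat.add_one_sub_one]
    push_cast
    linarith

theorem potential_le_stateg (hd : 0 ≤ d) (hc : 0 ≤ c) (hε : 0 ≤ ε) (hv : ∀ x, v x ≤ 1)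
    (hN : N ≠ 0) (r : ℕ) (x : G.X) :
    G.potential v c d (G.nextPhase v c ε N r x) x ≤ G.stateg x + (ε + c) +
      1 * (if G.nextPhase v c ε N r x = 0 then 0 else 1) := by
  by_cases h : G.nextPhase v c ε N r x = 0
  · rw [if_pos h, potential, if_pos h, bonusValue]
    split_ifs with hx
    · linarith
    · linarith [nextPhase_eq_zero hN h hx, G.stateg_active hx]
  · rw [if_neg h, G.stateg_active (nextPhase_ne_zero h)]
    linarith [potential_le hd hc hv (G.nextPhase v c ε N r x) x]

theorem phase_concat (l : List G.X) (x : G.X) :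
    G.phase v c ε N (l ++ [x]) = G.nextPhase v c ε N (G.phase v c ε N l) x := by
  simp [phase]

variable (v c ε N) in
/-- The block strategy of player 1. -/
def blockStrategy : G.toStocGame.Strategy1 :=
  .ofContinuation fun l x => G.stopValue v c (G.phase v c ε N (l ++ [x]) - 1)

theorem sum_stagePayoff_blockStrategy_ge (hd : 0 < d) (hc : 0 ≤ c) (hε : 0 ≤ ε)
    (hv : ∀ x, |v x| ≤ 1) (hvg : ∀ x, G.absorbing x → v x = G.stateg x) (hN : N ≠ 0)
    (hsub : ∀ x, G.bonusValue v c x ≤ G.oneShot (G.bonusValue v c) x)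
    (hgain : ∀ x, ¬ G.absorbing x → ε < v x →
      G.bonusValue v c x + d * N ≤ G.oneShot (G.stopValue v c (N - 1)) x)
    (x₁ : G.X) (τ : G.toStocGame.Strategy2) (n : ℕ) :
    n * (v x₁ - (ε + c)) - (2 + c) / d ≤
      ∑ t ∈ Finset.range n, G.stagePayoff x₁ (blockStrategy v c ε N) τ (t + 1) := by
  have hv1 : ∀ x, v x ≤ 1 := fun x => (abs_le.1 (hv x)).2
  have hx₁ : -1 ≤ v x₁ := (abs_le.1 (hv x₁)).1
  set σ : G.toStocGame.Strategy1 := blockStrategy v c ε N with hσ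
  let ph : List (G.X × G.A × G.B) → G.X → ℕ := fun h x =>
    G.phase v c ε N (h.map Prod.fst ++ [x])
  have hph : ∀ h x, ph h x = G.nextPhase v c ε N (G.phase v c ε N (h.map Prod.fst)) x :=
    fun h x => phase_concat _ _
  let Φ : List (G.X × G.A × G.B) → G.X → ℝ := fun h x => G.potential v c d (ph h x) x
  let I : List (G.X × G.A × G.B) → G.X → ℝ := fun h x => if ph h x = 0 then 0 else 1
  have hstep : ∀ t, G.histExp x₁ σ τ t Φ + d * G.histExp x₁ σ τ t I ≤
      G.histExp x₁ σ τ (t + 1) Φ := by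
    intro t
    rw [StocGame.histExp_succ, ← StocGame.histExp_mul, ← StocGame.histExp_add]
    refine G.histExp_mono x₁ σ τ fun h x _ => ?_
    refine (potential_add_le hsub (ph h x) x).trans ?_
    have h1 := G.oneShot_le (G.stopValue v c (ph h x - 1)) x (τ.mem h x)
    have h2 := bilinear_affine (G.nextExp (G.stopValue v c (ph h x - 1)) x) (σ.mem h x)
      (τ.mem h x) 1 (-(d * (ph h x - 1 : ℕ)))
    have h3 : σ.play h x = G.optA (G.stopValue v c (ph h x - 1)) x := rfl
    refine le_trans ?_ ((le_of_eq h2.symm).trans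
      (bilinear_mono (σ.mem h x) (τ.mem h x) fun a b => ?_))
    · rw [h3]
      linarith
    · rw [← StocGame.nextExp_affine]
      refine G.nextExp_mono (fun y => ?_) x a b
      have h4 := stopValue_le_potential hd.le hN hgain (ph h x) y
      have h5 : ph (h ++ [(x, a, b)]) y = G.nextPhase v c ε N (ph h x) y := by
        rw [hph]
        simp only [List.map_append, List.map_cons, List.map_nil]
        rfl
      simp only [Φ, h5]
      linarith
  have hpot : ∀ t, v x₁ + d * ∑ s ∈ Finset.range t, G.histExp x₁ σ τ s I ≤
      G.histExp x₁ σ τ t Φ := by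
    intro t
    induction t with
    | zero =>
      rw [StocGame.histExp_zero]
      have h1 := stopValue_le_potential hd.le hN hgain 0 x₁
      have h2 : Φ [] x₁ = G.potential v c d (G.nextPhase v c ε N 0 x₁) x₁ := by
        simp only [Φ, hph]
        rfl
      have h3 : v x₁ ≤ G.bonusValue v c x₁ := by
        rw [bonusValue]
        split_ifs with hx
        · linarith [hvg x₁ hx]
        · exact le_rfl
      rw [h2]
      simp only [stopValue, Nat.zero_sub, Nat.cast_zero, mul_zero, sub_zero] at h1
      simpa using h3.trans h1
    | succ t ih =>
      rw [Finset.sum_range_succ, mul_add]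
      linarith [hstep t]
  have hI : ∀ t, 0 ≤ G.histExp x₁ σ τ t I := fun t => by
    rw [← G.histExp_const x₁ σ τ t 0]
    refine G.histExp_mono x₁ σ τ fun h x _ => ?_
    simp only [I]
    split_ifs <;> norm_num
  have hsum : ∑ t ∈ Finset.range n, G.histExp x₁ σ τ t I ≤ (2 + c) / d := by
    rw [le_div_iff₀ hd]
    have h1 : G.histExp x₁ σ τ n Φ ≤ 1 + c := by
      rw [← G.histExp_const x₁ σ τ n (1 + c)]
      exact G.histExp_mono x₁ σ τ fun h x _ => potential_le hd.le hc hv1 _ _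
    linarith [hpot n]
  have hstage : ∀ t, v x₁ - (ε + c) - G.histExp x₁ σ τ t I ≤ G.stagePayoff x₁ σ τ (t + 1) := by
    intro t
    rw [stagePayoff_eq]
    have h1 : G.histExp x₁ σ τ t Φ ≤ G.histExp x₁ σ τ t fun h x =>
        (G.stateg x + (ε + c)) + 1 * I h x := by
      refine G.histExp_mono x₁ σ τ fun h x _ => ?_
      simp only [Φ, I, hph]
      exact potential_le_stateg hd.le hc hε hv1 hN _ x
    rw [StocGame.histExp_add, StocGame.histExp_add, StocGame.histExp_mul,
      StocGame.histExp_const] at h1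
    have h2 : 0 ≤ d * ∑ s ∈ Finset.range t, G.histExp x₁ σ τ s I :=
      mul_nonneg hd.le (Finset.sum_nonneg fun s _ => hI s)
    linarith [hpot t]
  have hfin := Finset.sum_le_sum (s := Finset.range n) fun t _ => hstage t
  rw [Finset.sum_sub_distrib, Finset.sum_const, Finset.card_range, nsmul_eq_mul] at hfin
  linarith

end

theorem limsupV_absorbing {x : G.X} (hx : G.absorbing x) : G.limsupV x = G.stateg x := by
  have h : (fun n => G.nValue n x) =ᶠ[atTop] fun _ => G.stateg x := by
    filter_upwards [eventually_ge_atTop 1] with n hn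
    have : (n : ℝ) ≠ 0 := by positivity
    rw [nValue_eq, G.totalValue_absorbing hx, inv_mul_cancel_left₀ this]
  rw [StocGame.limsupV, limsup_congr h, limsup_const]

theorem abs_limsupV_le (x : G.X) : |G.limsupV x| ≤ 1 := by
  obtain ⟨h1, h2⟩ := isBoundedUnder_of_abs_le fun n => G.abs_nValue_le n x
  refine abs_le.2 ⟨?_, ?_⟩
  · exact le_limsup_of_frequently_le
      (Frequently.of_forall fun n => (abs_le.1 (G.abs_nValue_le n x)).1) h1
  · exact limsup_le_of_le h2.isCoboundedUnder_le
      (Eventually.of_forall fun n => (abs_le.1 (G.abs_nValue_le n x)).2)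

theorem limsupV_le_oneShot (htb : G.TotallyBoundedValues) {x : G.X} (hx : ¬ G.absorbing x) :
    G.limsupV x ≤ G.oneShot G.limsupV x := by
  refine le_of_forall_pos_le_add fun δ hδ => ?_
  have h2 := (isBoundedUnder_of_abs_le fun n => G.abs_nValue_le n x).2
  refine limsup_le_of_le h2.isCoboundedUnder_le ?_
  obtain ⟨K, hK⟩ := exists_nat_gt (1 / (δ / 2))
  have hev := eventually_le_limsup_add G.abs_nValue_le htb (half_pos hδ)
  obtain ⟨M, hM⟩ := eventually_atTop.1 hev
  filter_upwards [eventually_ge_atTop (max M K + 1)] with n hn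
  obtain ⟨m, rfl⟩ : ∃ m, n = m + 1 := ⟨n - 1, by omega⟩
  have hmM : M ≤ m := (le_max_left M K).trans (by omega)
  have hmK' : K ≤ m := (le_max_right M K).trans (by omega)
  have hmK : (K : ℝ) ≤ m := by exact_mod_cast hmK'
  have h3 : ∀ y, G.totalValue m y ≤ (m + 1 : ℝ) * G.limsupV y + (m * (δ / 2) + 1) := by
    intro y
    rw [totalValue_eq]
    have h4 : (m : ℝ) * G.nValue m y ≤ m * (G.limsupV y + δ / 2) :=
      mul_le_mul_of_nonneg_left (hM m hmM y) (by positivity)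
    have := (abs_le.1 (G.abs_limsupV_le y)).1
    linarith
  have h5 := G.oneShot_le_affine h3 (by positivity) x
  have h6 : G.totalValue (m + 1) x ≤
      (m + 1 : ℝ) * G.oneShot G.limsupV x + (m * (δ / 2) + 1) := by
    rw [totalValue, G.stateg_active hx]
    linarith
  rw [totalValue_eq] at h6
  push_cast at h6
  have h7 : 1 < (m : ℝ) * (δ / 2) := by
    rw [div_lt_iff₀ (half_pos hδ)] at hK
    nlinarith
  by_contra! hcon
  have h8 : (m + 1 : ℝ) * (G.oneShot G.limsupV x + δ) < (m + 1) * G.nValue (m + 1) x :=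
    mul_lt_mul_of_pos_left hcon (by positivity)
  nlinarith

theorem bonusValue_le_oneShot (htb : G.TotallyBoundedValues) {c : ℝ} (hc : 0 ≤ c) (x : G.X) :
    G.bonusValue G.limsupV c x ≤ G.oneShot (G.bonusValue G.limsupV c) x := by
  by_cases hx : G.absorbing x
  · rw [G.oneShot_absorbing _ hx]
  · have e : G.bonusValue G.limsupV c x = G.limsupV x := if_neg hx
    rw [e]
    refine (G.limsupV_le_oneShot htb hx).trans (G.oneShot_mono (fun y => ?_) x)
    rw [bonusValue]
    split_ifs with hy
    · linarith [G.limsupV_absorbing hy]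
    · exact le_rfl

theorem exists_block_gain (htb : G.TotallyBoundedValues) {c ε δ : ℝ} (hc : 0 ≤ c) (hc1 : c ≤ 1)
    (hδ : 0 < δ) (hcε : 7 * δ ≤ c * ε) :
    ∃ N : ℕ, N ≠ 0 ∧ ∀ x, ¬ G.absorbing x → ε < G.limsupV x →
      G.bonusValue G.limsupV c x + δ ≤
        G.oneShot (G.stopValue G.limsupV c (N - 1)) x := by
  have hev := eventually_le_limsup_add G.abs_nValue_le htb hδ
  obtain ⟨M, hM⟩ := eventually_atTop.1 hev
  have hU : ∀ r x, G.totalValue r x ≤ r * G.limsupV x + (r * δ + 2 * M) := by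
    intro r x
    rcases le_total M r with hr | hr
    · rw [totalValue_eq]
      have h1 : (r : ℝ) * G.nValue r x ≤ r * (G.limsupV x + δ) :=
        mul_le_mul_of_nonneg_left (hM r hr x) (by positivity)
      have : (0 : ℝ) ≤ M := by positivity
      linarith
    · have h1 := G.totalValue_le r x
      have h2 : (r : ℝ) ≤ M := by exact_mod_cast hr
      have h3 : (r : ℝ) * (-1) ≤ r * G.limsupV x :=
        mul_le_mul_of_nonneg_left (abs_le.1 (G.abs_limsupV_le x)).1 (by positivity)
      have h4 : 0 ≤ (r : ℝ) * δ := by positivity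
      linarith
  obtain ⟨K, hK⟩ := exists_nat_gt (2 * M / δ)
  obtain ⟨N, hN⟩ := exists_bounded_limsup_sub_le G.abs_nValue_le htb hδ K
  refine ⟨N + 1, by omega, fun x hx hεx => ?_⟩
  obtain ⟨n, hKn, hnN, hn⟩ := hN x
  have hn0 : 0 < (n : ℝ) := by
    have h1 : (0 : ℝ) ≤ 2 * M / δ := by positivity
    have h2 : (K : ℝ) ≤ n := by exact_mod_cast hKn
    linarith
  have hMn : 2 * (M : ℝ) ≤ n * δ := by
    rw [div_lt_iff₀ hδ] at hK
    have h2 : (K : ℝ) ≤ n := by exact_mod_cast hKn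
    nlinarith
  have h1 := totalValue_le_stopValue hc hδ.le (by positivity) hU n x
  have hW : G.stopValue G.limsupV c n x ≤ G.stopValue G.limsupV c (N + 1) x :=
    stopValue_mono (by omega) x
  have h2 : (1 + c) * (G.limsupV x - 3 * δ) ≤ G.stopValue G.limsupV c n x := by
    rw [totalValue_eq] at h1
    have e : (n : ℝ) / (1 + c) * G.stopValue G.limsupV c n x =
      n * (G.stopValue G.limsupV c n x / (1 + c)) := by ring
    rw [e] at h1
    have h3 : (n : ℝ) * (G.nValue n x - 2 * δ) ≤
      n * (G.stopValue G.limsupV c n x / (1 + c)) := by linarith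
    have h4 := le_of_mul_le_mul_left h3 hn0
    rw [le_div_iff₀ (by linarith)] at h4
    have h5 : G.limsupV x - δ ≤ G.nValue n x := hn
    have h6 := mul_le_mul_of_nonneg_right
      (show G.limsupV x - 3 * δ ≤ G.nValue n x - 2 * δ by linarith) (show 0 ≤ 1 + c by linarith)
    linarith
  have h3 : G.bonusValue G.limsupV c x = G.limsupV x := if_neg hx
  have h4 : G.limsupV x + δ ≤ G.stopValue G.limsupV c (N + 1) x := by
    nlinarith
  have hε : 0 < ε := by
    by_contra! hcon
    nlinarith
  rw [stopValue, if_pos ⟨hx, hε.trans hεx⟩, h3] at h4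
  rw [h3]
  rcases le_max_iff.1 h4 with h | h
  · linarith
  · exact h

/-- Player 1 uniformly guarantees the limit superior of the values with strategies that depend
only on the sequence of states. -/
theorem exists_guarantee_limsupV (htb : G.TotallyBoundedValues) {ε : ℝ} (hε : 0 < ε) :
    ∃ σ : G.toStocGame.Strategy1, σ.stateDep ∧ ∃ N₀ : ℕ, 1 ≤ N₀ ∧ ∀ x₁, ∀ n ≥ N₀,
      ∀ τ : G.toStocGame.Strategy2, G.limsupV x₁ - ε ≤ G.avgPayoff x₁ σ τ n := by
  set c := min (ε / 3) 1 with hc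
  have hc0 : 0 < c := by positivity
  have hc1 : c ≤ 1 := min_le_right _ _
  have hc2 : c ≤ ε / 3 := min_le_left _ _
  obtain ⟨N, hN, hgain⟩ := G.exists_block_gain htb (c := c) (ε := c) (δ := c * c / 7) hc0.le hc1
    (by positivity) (by linarith)
  have hN' : (0 : ℝ) < N := by positivity
  set d := c * c / 7 / N with hd
  have hd0 : 0 < d := by positivity
  have hdN : d * N = c * c / 7 := div_mul_cancel₀ _ hN'.ne'
  obtain ⟨K, hK⟩ := exists_nat_gt ((2 + c) / d / c)
  refine ⟨blockStrategy G.limsupV c c N, StocGame.Strategy1.ofContinuation_stateDep _, K + 1,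
    by omega, fun x₁ n hn τ => ?_⟩
  have h1 := sum_stagePayoff_blockStrategy_ge hd0 hc0.le hc0.le G.abs_limsupV_le
    (fun x hx => G.limsupV_absorbing hx) hN (fun x => G.bonusValue_le_oneShot htb hc0.le x)
    (fun x hx hcx => by rw [hdN]; exact hgain x hx hcx) x₁ τ n
  have hKn : (K : ℝ) ≤ n := by exact_mod_cast (by omega : K ≤ n)
  have hn0 : (0 : ℝ) < n := by
    have : 0 < n := by omega
    exact_mod_cast this
  rw [div_lt_iff₀ hc0] at hK
  have h2 : (2 + c) / d ≤ n * c := hK.le.trans (mul_le_mul_of_nonneg_right hKn hc0.le)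
  rw [StocGame.avgPayoff_eq, inv_mul_eq_div, le_div_iff₀ hn0]
  nlinarith

theorem totallyBoundedValues_swap (htb : G.TotallyBoundedValues) :
    G.swap.TotallyBoundedValues := by
  intro ε hε
  obtain ⟨S, hS, h⟩ := htb ε hε
  refine ⟨S, hS, fun n hn => ?_⟩
  obtain ⟨m, hm, hnm⟩ := h n hn
  refine ⟨m, hm, fun x => ?_⟩
  rw [nValue_swap, nValue_swap, neg_sub_neg, abs_sub_comm]
  exact hnm x

theorem neg_limsupV_swap_le (x : G.X) : -G.swap.limsupV x ≤ G.limsupV x := by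
  obtain ⟨h1, h2⟩ := isBoundedUnder_of_abs_le fun n => G.abs_nValue_le n x
  obtain ⟨h3, h4⟩ := isBoundedUnder_of_abs_le fun n => G.swap.abs_nValue_le n x
  refine le_of_forall_pos_le_add fun δ hδ => ?_
  have hev : ∀ᶠ n in atTop, G.nValue n x < G.limsupV x + δ :=
    eventually_lt_of_limsup_lt (by simpa [StocGame.limsupV] using hδ) h1
  have : -(G.limsupV x + δ) ≤ G.swap.limsupV x := by
    refine le_limsup_of_frequently_le (hev.mono fun n hn => ?_).frequently h3
    rw [nValue_swap]
    linarith
  linarith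

end RecGame

/-- Let `Γ` be a two-player zero-sum recursive game with countable
state space and finite action sets at each state. If the family `{v_n : n ≥ 1}` of
`n`-stage value functions is totally bounded for the uniform norm, then `Γ` has a
uniform value `v_∞`; moreover both players can uniformly guarantee `v_∞` with
strategies that depend on the history only through the sequence of states visited. -/
theorem recursive_game_uniform_value_of_totallyBounded
    (G : RecGame) (hcount : Countable G.X)
    (htb : G.toStocGame.TotallyBoundedValues) :
    ∃ vinf : G.X → ℝ,
      (∀ ε > (0 : ℝ), ∃ σ : G.toStocGame.Strategy1, σ.stateDep ∧ ∃ N₀ : ℕ, 1 ≤ N₀ ∧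
        ∀ x₁, ¬ G.absorbing x₁ → ∀ n ≥ N₀, ∀ τ : G.toStocGame.Strategy2,
          G.toStocGame.avgPayoff x₁ σ τ n ≥ vinf x₁ - ε) ∧
      (∀ ε > (0 : ℝ), ∃ τ : G.toStocGame.Strategy2, τ.stateDep ∧ ∃ N₀ : ℕ, 1 ≤ N₀ ∧
        ∀ x₁, ¬ G.absorbing x₁ → ∀ n ≥ N₀, ∀ σ : G.toStocGame.Strategy1,
          G.toStocGame.avgPayoff x₁ σ τ n ≤ vinf x₁ + ε) := by
  refine ⟨G.limsupV, fun ε hε => ?_, fun ε hε => ?_⟩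
  · obtain ⟨σ, hσ, N₀, hN₀, h⟩ := G.exists_guarantee_limsupV htb hε
    exact ⟨σ, hσ, N₀, hN₀, fun x₁ _ n hn τ => h x₁ n hn τ⟩
  · obtain ⟨σ', hσ', N₀, hN₀, h⟩ :=
      G.swap.exists_guarantee_limsupV (G.totallyBoundedValues_swap htb) hε
    obtain ⟨τ, rfl, hτ⟩ := StocGame.exists_toSwap_eq σ'
    refine ⟨τ, hτ hσ', N₀, hN₀, fun x₁ _ n hn σ => ?_⟩
    have h1 := (h x₁ n hn σ.toSwap).trans_eq (G.toStocGame.avgPayoff_swap x₁ σ τ n)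
    have h2 := G.neg_limsupV_swap_le x₁
    linarith
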